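/- Let ε > 0 and let (b,ψ) be a configuration on ℝ² such that F₁₂, ε²F₁₂², |D₁ψ|² + |D₂ψ|², and (1 − |ψ|²)² are Lebesgue integrable on ℝ², and such that there exists a sequence R_m → ∞ with ∫_{{|y| = R_m}} |ψ|·(|D₁ψ| + |D₂ψ|) dσ → 0 as m → ∞. Then E_ε(b,ψ) ≥ ∫_{ℝ²} F₁₂, and equality holds if and only if (b,ψ) solves the vortex equations on all of ℝ². -/

import Mathlib

noncomputable section

open Complex MeasureTheory Filter

/-- First partial derivative on `ℝ²`. -/
def pd1 {V : Type*} [NormedAddCommGroup V] [NormedSpace ℝ V] (f : ℝ × ℝ → V) (y : ℝ × ℝ) : V :=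
  fderiv ℝ f y (1, 0)

/-- Second partial derivative on `ℝ²`. -/
def pd2 {V : Type*} [NormedAddCommGroup V] [NormedSpace ℝ V] (f : ℝ × ℝ → V) (y : ℝ × ℝ) : V :=
  fderiv ℝ f y (0, 1)

/-- First covariant derivative `D₁u = ∂₁u + i b₁ u`. -/
def D1 (b1 : ℝ × ℝ → ℝ) (ψ : ℝ × ℝ → ℂ) (y : ℝ × ℝ) : ℂ := pd1 ψ y + I * b1 y * ψ y

/-- Second covariant derivative `D₂u = ∂₂u + i b₂ u`. -/
def D2 (b2 : ℝ × ℝ → ℝ) (ψ : ℝ × ℝ → ℂ) (y : ℝ × ℝ) : ℂ := pd2 ψ y + I * b2 y * ψ y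

/-- Curvature `F₁₂ = ∂₁b₂ − ∂₂b₁`. -/
def F12 (b1 b2 : ℝ × ℝ → ℝ) (y : ℝ × ℝ) : ℝ := pd1 b2 y - pd2 b1 y

lemma fderiv_apply_eq_pd (f : ℝ × ℝ → ℝ) (y : ℝ × ℝ) (a b : ℝ) :
    fderiv ℝ f y (a, b) = a * pd1 f y + b * pd2 f y := by
  have h : ((a, b) : ℝ × ℝ) = a • (1, 0) + b • (0, 1) := by simp
  rw [h, map_add, map_smul, map_smul]
  rfl

lemma contDiff_pd1 {V : Type*} [NormedAddCommGroup V] [NormedSpace ℝ V] {f : ℝ × ℝ → V}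
    (hf : ContDiff ℝ (⊤ : ℕ∞) f) : ContDiff ℝ (⊤ : ℕ∞) (pd1 f) :=
  (hf.fderiv_right (m := (⊤ : ℕ∞)) le_rfl).clm_apply contDiff_const

lemma contDiff_pd2 {V : Type*} [NormedAddCommGroup V] [NormedSpace ℝ V] {f : ℝ × ℝ → V}
    (hf : ContDiff ℝ (⊤ : ℕ∞) f) : ContDiff ℝ (⊤ : ℕ∞) (pd2 f) :=
  (hf.fderiv_right (m := (⊤ : ℕ∞)) le_rfl).clm_apply contDiff_const

lemma pd1_pd2_comm {f : ℝ × ℝ → ℝ} (hf : ContDiff ℝ (⊤ : ℕ∞) f) (y : ℝ × ℝ) :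
    pd1 (pd2 f) y = pd2 (pd1 f) y := by
  have hd : DifferentiableAt ℝ (fderiv ℝ f) y :=
    (hf.fderiv_right (m := (⊤ : ℕ∞)) le_rfl).differentiable (by simp) y
  have hs : IsSymmSndFDerivAt ℝ f y :=
    hf.contDiffAt.isSymmSndFDerivAt (by
      rw [minSmoothness_of_isRCLikeNormedField]
      exact WithTop.coe_le_coe.2 (le_top : (2 : ℕ∞) ≤ ⊤))
  have key (v w : ℝ × ℝ) :
      fderiv ℝ (fun z => fderiv ℝ f z v) y w = fderiv ℝ (fderiv ℝ f) y w v := by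
    rw [fderiv_clm_apply hd (differentiableAt_const v)]
    simp
  unfold pd1 pd2
  rw [key, key]
  exact hs _ _

section Polar

variable {J1 J2 : ℝ × ℝ → ℝ}

lemma hasDerivAt_comp_radial {J : ℝ × ℝ → ℝ} (hJ : Differentiable ℝ J) (r θ : ℝ) :
    HasDerivAt (fun r => J (r * Real.cos θ, r * Real.sin θ))
      (Real.cos θ * pd1 J (r * Real.cos θ, r * Real.sin θ)
        + Real.sin θ * pd2 J (r * Real.cos θ, r * Real.sin θ)) r := by
  have h : HasDerivAt (fun r : ℝ => (r * Real.cos θ, r * Real.sin θ))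
      (Real.cos θ, Real.sin θ) r := by
    simpa using ((hasDerivAt_id r).mul_const (Real.cos θ)).prodMk
      ((hasDerivAt_id r).mul_const (Real.sin θ))
  have := (hJ (r * Real.cos θ, r * Real.sin θ)).hasFDerivAt.comp_hasDerivAt r h
  rwa [fderiv_apply_eq_pd] at this

lemma hasDerivAt_comp_angular {J : ℝ × ℝ → ℝ} (hJ : Differentiable ℝ J) (r θ : ℝ) :
    HasDerivAt (fun θ => J (r * Real.cos θ, r * Real.sin θ))
      (-(r * Real.sin θ) * pd1 J (r * Real.cos θ, r * Real.sin θ)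
        + r * Real.cos θ * pd2 J (r * Real.cos θ, r * Real.sin θ)) θ := by
  have h : HasDerivAt (fun θ : ℝ => (r * Real.cos θ, r * Real.sin θ))
      (-(r * Real.sin θ), r * Real.cos θ) θ := by
    simpa using ((Real.hasDerivAt_cos θ).const_mul r).prodMk
      ((Real.hasDerivAt_sin θ).const_mul r)
  have := (hJ (r * Real.cos θ, r * Real.sin θ)).hasFDerivAt.comp_hasDerivAt θ h
  rwa [fderiv_apply_eq_pd] at this

/-- Green's theorem on a disk, in polar coordinates. -/
lemma integral_curl_disk (h1 : ContDiff ℝ (⊤ : ℕ∞) J1) (h2 : ContDiff ℝ (⊤ : ℕ∞) J2) (R : ℝ) :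
    (∫ r in (0 : ℝ)..R, ∫ θ in (-Real.pi)..Real.pi,
      r * (pd1 J2 (r * Real.cos θ, r * Real.sin θ) - pd2 J1 (r * Real.cos θ, r * Real.sin θ))) =
    ∫ θ in (-Real.pi)..Real.pi, R * (Real.cos θ * J2 (R * Real.cos θ, R * Real.sin θ)
      - Real.sin θ * J1 (R * Real.cos θ, R * Real.sin θ)) := by
  have d1 : Differentiable ℝ J1 := h1.differentiable (by simp)
  have d2 : Differentiable ℝ J2 := h2.differentiable (by simp)
  set f : ℝ × ℝ → ℝ := fun p => p.1 * (Real.cos p.2 * J2 (p.1 * Real.cos p.2, p.1 * Real.sin p.2)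
      - Real.sin p.2 * J1 (p.1 * Real.cos p.2, p.1 * Real.sin p.2)) with hf
  set g : ℝ × ℝ → ℝ := fun p => -(Real.cos p.2 * J1 (p.1 * Real.cos p.2, p.1 * Real.sin p.2)
      + Real.sin p.2 * J2 (p.1 * Real.cos p.2, p.1 * Real.sin p.2)) with hg
  have df : Differentiable ℝ f := by fun_prop
  have dg : Differentiable ℝ g := by fun_prop
  have hdiv (r θ : ℝ) : fderiv ℝ f (r, θ) (1, 0) + fderiv ℝ g (r, θ) (0, 1) =
      r * (pd1 J2 (r * Real.cos θ, r * Real.sin θ)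
        - pd2 J1 (r * Real.cos θ, r * Real.sin θ)) := by
    have ef : HasDerivAt (fun r => f (r, θ)) (fderiv ℝ f (r, θ) (1, 0)) r :=
      (df (r, θ)).hasFDerivAt.comp_hasDerivAt r
        (f := fun r => (r, θ)) ((hasDerivAt_id r).prodMk (hasDerivAt_const r θ))
    have eg : HasDerivAt (fun θ => g (r, θ)) (fderiv ℝ g (r, θ) (0, 1)) θ :=
      (dg (r, θ)).hasFDerivAt.comp_hasDerivAt θ ((hasDerivAt_const θ r).prodMk (hasDerivAt_id θ))
    have ef' := (hasDerivAt_id r).mul (((hasDerivAt_comp_radial d2 r θ).const_mul (Real.cos θ)).sub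
      ((hasDerivAt_comp_radial d1 r θ).const_mul (Real.sin θ)))
    have eg' := (((Real.hasDerivAt_cos θ).mul (hasDerivAt_comp_angular d1 r θ)).add
      ((Real.hasDerivAt_sin θ).mul (hasDerivAt_comp_angular d2 r θ))).neg
    rw [ef.unique ef', eg.unique eg']
    simp only [id, Pi.sub_apply]
    linear_combination (r * (pd1 J2 (r * Real.cos θ, r * Real.sin θ)
        - pd2 J1 (r * Real.cos θ, r * Real.sin θ))) * Real.sin_sq_add_cos_sq θ
  have c1 : Continuous (pd2 J1) := (contDiff_pd2 h1).continuous
  have c2 : Continuous (pd1 J2) := (contDiff_pd1 h2).continuous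
  have hcont : Continuous fun p : ℝ × ℝ => fderiv ℝ f p (1, 0) + fderiv ℝ g p (0, 1) := by
    have : (fun p : ℝ × ℝ => fderiv ℝ f p (1, 0) + fderiv ℝ g p (0, 1)) = fun p : ℝ × ℝ =>
        p.1 * (pd1 J2 (p.1 * Real.cos p.2, p.1 * Real.sin p.2)
          - pd2 J1 (p.1 * Real.cos p.2, p.1 * Real.sin p.2)) := by
      funext p
      exact hdiv p.1 p.2
    rw [this]
    fun_prop
  have key := integral2_divergence_prod_of_hasFDerivAt f g (fderiv ℝ f) (fderiv ℝ g)
    0 (-Real.pi) R Real.pi df.continuous.continuousOn dg.continuous.continuousOn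
    (fun x _ => (df x).hasFDerivAt) (fun x _ => (dg x).hasFDerivAt)
    (hcont.continuousOn.integrableOn_compact (isCompact_uIcc.prod isCompact_uIcc))
  simp only [hdiv] at key
  rw [key]
  simp [hf, hg]

/-- A smooth integrable curl has vanishing integral when its circulation along circles of
radii `R j → ∞` tends to zero. -/
lemma integral_curl_eq_zero (h1 : ContDiff ℝ (⊤ : ℕ∞) J1) (h2 : ContDiff ℝ (⊤ : ℕ∞) J2)
    (hint : Integrable fun y => pd1 J2 y - pd2 J1 y)
    {R : ℕ → ℝ} (hR : Tendsto R atTop atTop)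
    (hcirc : Tendsto (fun j => ∫ θ in (-Real.pi)..Real.pi,
      R j * (Real.cos θ * J2 (R j * Real.cos θ, R j * Real.sin θ)
        - Real.sin θ * J1 (R j * Real.cos θ, R j * Real.sin θ))) atTop (nhds 0)) :
    ∫ y, (pd1 J2 y - pd2 J1 y) = 0 := by
  have hpi : -Real.pi ≤ Real.pi := by linarith [Real.pi_pos]
  set G : ℝ × ℝ → ℝ := fun y => pd1 J2 y - pd2 J1 y with hG
  have hpol : IntegrableOn (fun p : ℝ × ℝ => p.1 * G (polarCoord.symm p)) polarCoord.target := by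
    have h := (integrableOn_image_iff_integrableOn_abs_det_fderiv_smul volume
      polarCoord.open_target.measurableSet
      (fun p _ => (hasFDerivAt_polarCoord_symm p).hasFDerivWithinAt)
      polarCoord.symm.injOn G).1 hint.integrableOn
    refine h.congr_fun (fun p hp => ?_) polarCoord.open_target.measurableSet
    have hp0 : 0 < p.1 := hp.1
    simp [det_fderivPolarCoordSymm, abs_of_pos hp0]
  have hprod : Integrable (fun p : ℝ × ℝ => p.1 * G (polarCoord.symm p))
      ((volume.restrict (Set.Ioi 0)).prod (volume.restrict (Set.Ioo (-Real.pi) Real.pi))) := by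
    rw [Measure.prod_restrict]
    exact hpol
  have hlim := intervalIntegral_tendsto_integral_Ioi 0 hprod.integral_prod_left hR
  rw [← integral_prod _ hprod, Measure.prod_restrict] at hlim
  have htotal : (∫ p in (Set.Ioi (0 : ℝ)) ×ˢ Set.Ioo (-Real.pi) Real.pi,
      p.1 * G (polarCoord.symm p) ∂(volume.prod volume)) = ∫ y, G y :=
    integral_comp_polarCoord_symm G
  rw [htotal] at hlim
  refine tendsto_nhds_unique hlim (hcirc.congr fun j => ?_)
  rw [← integral_curl_disk h1 h2]
  refine intervalIntegral.integral_congr fun r _ => ?_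
  simp only [intervalIntegral.integral_of_le hpi, integral_Ioc_eq_integral_Ioo]
  rfl

end Polar

/-- A component of the current `Im (conj ψ · Dψ)` in terms of real and imaginary parts. -/
lemma im_conj_mul_eq (z dz : ℂ) (b : ℝ) :
    (starRingEnd ℂ z * (dz + I * b * z)).im =
      z.re * dz.im - z.im * dz.re + b * (z.re ^ 2 + z.im ^ 2) := by
  simp
  ring

lemma pd1_re {ψ : ℝ × ℝ → ℂ} (hψ : Differentiable ℝ ψ) (y : ℝ × ℝ) :
    pd1 (fun z => (ψ z).re) y = (pd1 ψ y).re := by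
  have := reCLM.hasFDerivAt.comp y (hψ y).hasFDerivAt
  unfold pd1
  exact congrArg (fun L : ℝ × ℝ →L[ℝ] ℝ => L (1, 0)) this.fderiv

lemma pd1_im {ψ : ℝ × ℝ → ℂ} (hψ : Differentiable ℝ ψ) (y : ℝ × ℝ) :
    pd1 (fun z => (ψ z).im) y = (pd1 ψ y).im := by
  have := imCLM.hasFDerivAt.comp y (hψ y).hasFDerivAt
  unfold pd1
  exact congrArg (fun L : ℝ × ℝ →L[ℝ] ℝ => L (1, 0)) this.fderiv

lemma pd2_re {ψ : ℝ × ℝ → ℂ} (hψ : Differentiable ℝ ψ) (y : ℝ × ℝ) :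
    pd2 (fun z => (ψ z).re) y = (pd2 ψ y).re := by
  have := reCLM.hasFDerivAt.comp y (hψ y).hasFDerivAt
  unfold pd2
  exact congrArg (fun L : ℝ × ℝ →L[ℝ] ℝ => L (0, 1)) this.fderiv

lemma pd2_im {ψ : ℝ × ℝ → ℂ} (hψ : Differentiable ℝ ψ) (y : ℝ × ℝ) :
    pd2 (fun z => (ψ z).im) y = (pd2 ψ y).im := by
  have := imCLM.hasFDerivAt.comp y (hψ y).hasFDerivAt
  unfold pd2
  exact congrArg (fun L : ℝ × ℝ →L[ℝ] ℝ => L (0, 1)) this.fderiv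

/-- Leibniz rule for the gauge-invariant current of `u + iv` with connection component `b`. -/
lemma fderiv_current {u v p q b : ℝ × ℝ → ℝ} {y : ℝ × ℝ}
    (hu : DifferentiableAt ℝ u y) (hv : DifferentiableAt ℝ v y) (hp : DifferentiableAt ℝ p y)
    (hq : DifferentiableAt ℝ q y) (hb : DifferentiableAt ℝ b y) (w : ℝ × ℝ) :
    fderiv ℝ (fun z => u z * q z - v z * p z + b z * (u z ^ 2 + v z ^ 2)) y w =
      fderiv ℝ u y w * q y + u y * fderiv ℝ q y w - fderiv ℝ v y w * p y - v y * fderiv ℝ p y w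
      + fderiv ℝ b y w * (u y ^ 2 + v y ^ 2)
      + b y * (2 * u y * fderiv ℝ u y w + 2 * v y * fderiv ℝ v y w) := by
  have h := ((hu.hasFDerivAt.mul hq.hasFDerivAt).sub (hv.hasFDerivAt.mul hp.hasFDerivAt)).add
    (hb.hasFDerivAt.mul ((hu.hasFDerivAt.pow 2).add (hv.hasFDerivAt.pow 2)))
  have h' : fderiv ℝ (fun z => u z * q z - v z * p z + b z * (u z ^ 2 + v z ^ 2)) y = _ := h.fderiv
  rw [h']
  simp
  ring

/-- The current `Im (conj ψ · D₁ψ)`. -/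
def current1 (b1 : ℝ × ℝ → ℝ) (ψ : ℝ × ℝ → ℂ) (y : ℝ × ℝ) : ℝ :=
  (starRingEnd ℂ (ψ y) * D1 b1 ψ y).im

/-- The current `Im (conj ψ · D₂ψ)`. -/
def current2 (b2 : ℝ × ℝ → ℝ) (ψ : ℝ × ℝ → ℂ) (y : ℝ × ℝ) : ℝ :=
  (starRingEnd ℂ (ψ y) * D2 b2 ψ y).im

section Current

variable {b1 b2 : ℝ × ℝ → ℝ} {ψ : ℝ × ℝ → ℂ}

lemma contDiff_D1 (hb1 : ContDiff ℝ (⊤ : ℕ∞) b1) (hψ : ContDiff ℝ (⊤ : ℕ∞) ψ) :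
    ContDiff ℝ (⊤ : ℕ∞) (D1 b1 ψ) :=
  (contDiff_pd1 hψ).add ((contDiff_const.mul (ofRealCLM.contDiff.comp hb1)).mul hψ)

lemma contDiff_D2 (hb2 : ContDiff ℝ (⊤ : ℕ∞) b2) (hψ : ContDiff ℝ (⊤ : ℕ∞) ψ) :
    ContDiff ℝ (⊤ : ℕ∞) (D2 b2 ψ) :=
  (contDiff_pd2 hψ).add ((contDiff_const.mul (ofRealCLM.contDiff.comp hb2)).mul hψ)

lemma contDiff_current1 (hb1 : ContDiff ℝ (⊤ : ℕ∞) b1) (hψ : ContDiff ℝ (⊤ : ℕ∞) ψ) :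
    ContDiff ℝ (⊤ : ℕ∞) (current1 b1 ψ) :=
  imCLM.contDiff.comp ((conjCLE.contDiff.comp hψ).mul (contDiff_D1 hb1 hψ))

lemma contDiff_current2 (hb2 : ContDiff ℝ (⊤ : ℕ∞) b2) (hψ : ContDiff ℝ (⊤ : ℕ∞) ψ) :
    ContDiff ℝ (⊤ : ℕ∞) (current2 b2 ψ) :=
  imCLM.contDiff.comp ((conjCLE.contDiff.comp hψ).mul (contDiff_D2 hb2 hψ))

/-- Pointwise Bogomolny identity for the covariant derivatives. -/
lemma norm_sq_D1_sub_I_mul_D2 (hb1 : ContDiff ℝ (⊤ : ℕ∞) b1) (hb2 : ContDiff ℝ (⊤ : ℕ∞) b2)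
    (hψ : ContDiff ℝ (⊤ : ℕ∞) ψ) (y : ℝ × ℝ) :
    ‖D1 b1 ψ y - I * D2 b2 ψ y‖ ^ 2 = ‖D1 b1 ψ y‖ ^ 2 + ‖D2 b2 ψ y‖ ^ 2
      + (pd1 (current2 b2 ψ) y - pd2 (current1 b1 ψ) y) - F12 b1 b2 y * ‖ψ y‖ ^ 2 := by
  have dψ : Differentiable ℝ ψ := hψ.differentiable (by simp)
  set u : ℝ × ℝ → ℝ := fun z => (ψ z).re with hu
  set v : ℝ × ℝ → ℝ := fun z => (ψ z).im with hv
  have su : ContDiff ℝ (⊤ : ℕ∞) u := reCLM.contDiff.comp hψ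
  have sv : ContDiff ℝ (⊤ : ℕ∞) v := imCLM.contDiff.comp hψ
  have diff {f : ℝ × ℝ → ℝ} (hf : ContDiff ℝ (⊤ : ℕ∞) f) : DifferentiableAt ℝ f y :=
    hf.differentiable (by simp) y
  have e1 : current1 b1 ψ = fun z => u z * pd1 v z - v z * pd1 u z
      + b1 z * (u z ^ 2 + v z ^ 2) := by
    funext z
    rw [pd1_re dψ, pd1_im dψ]
    exact im_conj_mul_eq _ _ _
  have e2 : current2 b2 ψ = fun z => u z * pd2 v z - v z * pd2 u z
      + b2 z * (u z ^ 2 + v z ^ 2) := by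
    funext z
    rw [pd2_re dψ, pd2_im dψ]
    exact im_conj_mul_eq _ _ _
  have c1 : pd2 (current1 b1 ψ) y = pd2 u y * pd1 v y + u y * pd2 (pd1 v) y - pd2 v y * pd1 u y
      - v y * pd2 (pd1 u) y + pd2 b1 y * (u y ^ 2 + v y ^ 2)
      + b1 y * (2 * u y * pd2 u y + 2 * v y * pd2 v y) := by
    rw [e1]
    exact fderiv_current (diff su) (diff sv) (diff (contDiff_pd1 su)) (diff (contDiff_pd1 sv))
      (diff hb1) _
  have c2 : pd1 (current2 b2 ψ) y = pd1 u y * pd2 v y + u y * pd1 (pd2 v) y - pd1 v y * pd2 u y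
      - v y * pd1 (pd2 u) y + pd1 b2 y * (u y ^ 2 + v y ^ 2)
      + b2 y * (2 * u y * pd1 u y + 2 * v y * pd1 v y) := by
    rw [e2]
    exact fderiv_current (diff su) (diff sv) (diff (contDiff_pd2 su)) (diff (contDiff_pd2 sv))
      (diff hb2) _
  rw [c1, c2, pd1_pd2_comm su, pd1_pd2_comm sv]
  simp only [← normSq_eq_norm_sq, normSq_apply, D1, D2, F12, hu, hv, pd1_re dψ, pd1_im dψ,
    pd2_re dψ, pd2_im dψ]
  simp
  ring

lemma abs_current1_le (y : ℝ × ℝ) : |current1 b1 ψ y| ≤ ‖ψ y‖ * ‖D1 b1 ψ y‖ := by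
  simpa [current1] using abs_im_le_norm (starRingEnd ℂ (ψ y) * D1 b1 ψ y)

lemma abs_current2_le (y : ℝ × ℝ) : |current2 b2 ψ y| ≤ ‖ψ y‖ * ‖D2 b2 ψ y‖ := by
  simpa [current2] using abs_im_le_norm (starRingEnd ℂ (ψ y) * D2 b2 ψ y)

/-- The circulation of the current tends to zero when `|ψ| |Dψ|` has vanishing integral along
the circles. -/
lemma tendsto_circulation_current (hb1 : ContDiff ℝ (⊤ : ℕ∞) b1)
    (hb2 : ContDiff ℝ (⊤ : ℕ∞) b2) (hψ : ContDiff ℝ (⊤ : ℕ∞) ψ)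
    {R : ℕ → ℝ} (hR : Tendsto R atTop atTop)
    (hcirc : Tendsto (fun j => ∫ θ in (0:ℝ)..(2 * Real.pi),
        R j * (‖ψ (R j * Real.cos θ, R j * Real.sin θ)‖ *
          (‖D1 b1 ψ (R j * Real.cos θ, R j * Real.sin θ)‖ +
           ‖D2 b2 ψ (R j * Real.cos θ, R j * Real.sin θ)‖)))
      atTop (nhds 0)) :
    Tendsto (fun j => ∫ θ in (-Real.pi)..Real.pi,
      R j * (Real.cos θ * current2 b2 ψ (R j * Real.cos θ, R j * Real.sin θ)
        - Real.sin θ * current1 b1 ψ (R j * Real.cos θ, R j * Real.sin θ))) atTop (nhds 0) := by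
  refine squeeze_zero_norm' ?_ hcirc
  filter_upwards [hR.eventually_ge_atTop 0] with j hj
  have hpi : -Real.pi ≤ Real.pi := by linarith [Real.pi_pos]
  have k1 : Continuous (D1 b1 ψ) := (contDiff_D1 hb1 hψ).continuous
  have k2 : Continuous (D2 b2 ψ) := (contDiff_D2 hb2 hψ).continuous
  have k3 : Continuous ψ := hψ.continuous
  have hper : Function.Periodic (fun θ : ℝ => R j * (‖ψ (R j * Real.cos θ, R j * Real.sin θ)‖ *
      (‖D1 b1 ψ (R j * Real.cos θ, R j * Real.sin θ)‖ +
       ‖D2 b2 ψ (R j * Real.cos θ, R j * Real.sin θ)‖))) (2 * Real.pi) := fun θ => by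
    simp only [Real.cos_add_two_pi, Real.sin_add_two_pi]
  have hshift := hper.intervalIntegral_add_eq 0 (-Real.pi)
  rw [zero_add, show -Real.pi + 2 * Real.pi = Real.pi by ring] at hshift
  rw [hshift]
  refine intervalIntegral.norm_integral_le_of_norm_le hpi (Eventually.of_forall fun θ _ => ?_)
    (Continuous.intervalIntegrable (by fun_prop) _ _)
  set y : ℝ × ℝ := (R j * Real.cos θ, R j * Real.sin θ)
  rw [norm_mul, Real.norm_of_nonneg hj]
  refine mul_le_mul_of_nonneg_left ?_ hj
  calc ‖Real.cos θ * current2 b2 ψ y - Real.sin θ * current1 b1 ψ y‖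
      ≤ |Real.cos θ| * |current2 b2 ψ y| + |Real.sin θ| * |current1 b1 ψ y| := by
        rw [← abs_mul, ← abs_mul]
        exact abs_sub _ _
    _ ≤ 1 * (‖ψ y‖ * ‖D2 b2 ψ y‖) + 1 * (‖ψ y‖ * ‖D1 b1 ψ y‖) := by
        gcongr
        exacts [Real.abs_cos_le_one θ, abs_current2_le y, Real.abs_sin_le_one θ, abs_current1_le y]
    _ = ‖ψ y‖ * (‖D1 b1 ψ y‖ + ‖D2 b2 ψ y‖) := by ring

end Current

/-- the Bogomolny lower bound `E_ε(b,ψ) ≥ ∫ F₁₂`, with equality iff the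
vortex equations hold. -/
theorem energy_lower_bound (ε : ℝ) (hε : 0 < ε)
    (b1 b2 : ℝ × ℝ → ℝ) (ψ : ℝ × ℝ → ℂ)
    (hb1 : ContDiff ℝ (⊤ : ℕ∞) b1) (hb2 : ContDiff ℝ (⊤ : ℕ∞) b2)
    (hψ : ContDiff ℝ (⊤ : ℕ∞) ψ)
    (hint1 : Integrable (fun y => F12 b1 b2 y))
    (hint2 : Integrable (fun y => ε ^ 2 * (F12 b1 b2 y) ^ 2))
    (hint3 : Integrable (fun y => ‖D1 b1 ψ y‖ ^ 2 + ‖D2 b2 ψ y‖ ^ 2))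
    (hint4 : Integrable (fun y => (1 - ‖ψ y‖ ^ 2) ^ 2))
    (R : ℕ → ℝ) (hR : Tendsto R atTop atTop)
    (hcirc : Tendsto (fun j => ∫ θ in (0:ℝ)..(2 * Real.pi),
        R j * (‖ψ (R j * Real.cos θ, R j * Real.sin θ)‖ *
          (‖D1 b1 ψ (R j * Real.cos θ, R j * Real.sin θ)‖ +
           ‖D2 b2 ψ (R j * Real.cos θ, R j * Real.sin θ)‖)))
      atTop (nhds 0)) :
    (∫ y : ℝ × ℝ, F12 b1 b2 y) ≤
      (∫ y : ℝ × ℝ, (ε ^ 2 * (F12 b1 b2 y) ^ 2 + ‖D1 b1 ψ y‖ ^ 2 + ‖D2 b2 ψ y‖ ^ 2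
        + (1 - ‖ψ y‖ ^ 2) ^ 2 / (4 * ε ^ 2))) ∧
    ((∫ y : ℝ × ℝ, (ε ^ 2 * (F12 b1 b2 y) ^ 2 + ‖D1 b1 ψ y‖ ^ 2 + ‖D2 b2 ψ y‖ ^ 2
        + (1 - ‖ψ y‖ ^ 2) ^ 2 / (4 * ε ^ 2))) = (∫ y : ℝ × ℝ, F12 b1 b2 y) ↔
      ∀ y : ℝ × ℝ, ε * F12 b1 b2 y = (1 - ‖ψ y‖ ^ 2) / (2 * ε) ∧
        D1 b1 ψ y - I * D2 b2 ψ y = 0) := by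
  have sJ1 := contDiff_current1 hb1 hψ
  have sJ2 := contDiff_current2 hb2 hψ
  have cF : Continuous (F12 b1 b2) :=
    (contDiff_pd1 hb2).continuous.sub (contDiff_pd2 hb1).continuous
  have cD1 : Continuous (D1 b1 ψ) := (contDiff_D1 hb1 hψ).continuous
  have cD2 : Continuous (D2 b2 ψ) := (contDiff_D2 hb2 hψ).continuous
  have cψ : Continuous ψ := hψ.continuous
  have hε0 : ε ≠ 0 := hε.ne'
  set E : ℝ × ℝ → ℝ := fun y => ε ^ 2 * (F12 b1 b2 y) ^ 2 + ‖D1 b1 ψ y‖ ^ 2 + ‖D2 b2 ψ y‖ ^ 2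
        + (1 - ‖ψ y‖ ^ 2) ^ 2 / (4 * ε ^ 2) with hE
  set S : ℝ × ℝ → ℝ := fun y => (ε * F12 b1 b2 y - (1 - ‖ψ y‖ ^ 2) / (2 * ε)) ^ 2
    + ‖D1 b1 ψ y - I * D2 b2 ψ y‖ ^ 2 with hS
  set C : ℝ × ℝ → ℝ := fun y => pd1 (current2 b2 ψ) y - pd2 (current1 b1 ψ) y with hC
  have cS : Continuous S := by fun_prop
  have hS0 : 0 ≤ S := fun y => by positivity
  have hbog (y : ℝ × ℝ) : S y = E y - F12 b1 b2 y + C y := by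
    simp only [hS, hE, hC, norm_sq_D1_sub_I_mul_D2 hb1 hb2 hψ y]
    field_simp
    ring
  have iE : Integrable E := by
    refine ((hint2.add hint3).add (hint4.div_const (4 * ε ^ 2))).congr (.of_forall fun y => ?_)
    simp only [hE, Pi.add_apply]
    ring
  have iS : Integrable S := by
    refine (iE.const_mul 2).mono' cS.aestronglyMeasurable (.of_forall fun y => ?_)
    rw [Real.norm_of_nonneg (hS0 y)]
    have hn : ‖D1 b1 ψ y - I * D2 b2 ψ y‖ ≤ ‖D1 b1 ψ y‖ + ‖D2 b2 ψ y‖ := by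
      simpa using norm_sub_le (D1 b1 ψ y) (I * D2 b2 ψ y)
    have hn2 : ‖D1 b1 ψ y - I * D2 b2 ψ y‖ ^ 2 ≤ 2 * (‖D1 b1 ψ y‖ ^ 2 + ‖D2 b2 ψ y‖ ^ 2) :=
      (pow_le_pow_left₀ (norm_nonneg _) hn 2).trans add_sq_le
    have hq : (1 - ‖ψ y‖ ^ 2) ^ 2 / (4 * ε ^ 2) = ((1 - ‖ψ y‖ ^ 2) / (2 * ε)) ^ 2 := by
      field_simp
      norm_num
    simp only [hS, hE, hq]
    nlinarith [sq_nonneg (ε * F12 b1 b2 y + (1 - ‖ψ y‖ ^ 2) / (2 * ε))]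
  have iC : Integrable C :=
    ((iS.sub iE).add hint1).congr (.of_forall fun y => by
      simp only [Pi.add_apply, Pi.sub_apply, hbog y]
      ring)
  have hC0 : ∫ y, C y = 0 := integral_curl_eq_zero sJ1 sJ2 iC hR
    (tendsto_circulation_current hb1 hb2 hψ hR hcirc)
  have hSint : ∫ y, S y = (∫ y, E y) - ∫ y, F12 b1 b2 y := by
    simp only [hbog]
    rw [integral_add (f := fun y => E y - F12 b1 b2 y) (iE.sub hint1) iC, integral_sub iE hint1,
      hC0, add_zero]
  have hzero : (∫ y, S y) = 0 ↔ ∀ y, S y = 0 := by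
    rw [integral_eq_zero_iff_of_nonneg hS0 iS, cS.ae_eq_iff_eq volume continuous_zero, funext_iff]
    rfl
  refine ⟨sub_nonneg.1 (hSint ▸ integral_nonneg hS0), ?_⟩
  rw [← sub_eq_zero, ← hSint, hzero]
  refine forall_congr' fun y => ?_
  simp only [hS]
  rw [add_eq_zero_iff_of_nonneg (sq_nonneg _) (sq_nonneg _), sq_eq_zero_iff, sq_eq_zero_iff,
    norm_eq_zero, sub_eq_zero]
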